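/- arXiv:1002.4704 — 8 statements merged into one kernel-verified Lean document; each statement's English description precedes it below -/
import Mathlib

section
/- If D is an acyclic digraph and v is a vertex of D, then the local complement D*v is also an acyclic digraph. -/
/-!
Digraphs on a finite vertex set `V` are modelled as irreflexive relations,
encoded as functions `V → V → Bool`.
-/

variable {V : Type*} [Fintype V] [DecidableEq V]

/-- The in-neighborhood `N⁻_D(v)` of a vertex `v`. -/
def inN (D : V → V → Bool) (v : V) : Finset V :=
  Finset.univ.filter fun u => D u v = true

/-- The out-neighborhood `N⁺_D(v)` of a vertex `v`. -/
def outN (D : V → V → Bool) (v : V) : Finset V :=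
  Finset.univ.filter fun w => D v w = true

/-- The out-degree `deg⁺_D(v)` of a vertex `v`. -/
def outDeg (D : V → V → Bool) (v : V) : ℕ := (outN D v).card

/-- Local complementation `D*v`: for each pair `(u,w) ∈ N⁻_D(v) × N⁺_D(v)` with
`u ≠ w`, the arc `(u,w)` is toggled. -/
def localComp (D : V → V → Bool) (v : V) : V → V → Bool :=
  fun u w => if u ≠ w ∧ D u v = true ∧ D v w = true then !(D u w) else D u w

/-- The slide `D Δ vw`: the out-neighborhood of `w` is replaced by the symmetric
difference `N⁺_D(w) Δ N⁺_D(v)`; all other arcs are unchanged. -/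
def slide (D : V → V → Bool) (v w : V) : V → V → Bool :=
  fun a b => if a = w then xor (D w b) (D v b) else D a b

/-- A digraph is acyclic if it has no directed cycle, i.e. its transitive
closure is irreflexive. -/
def IsAcyclic (D : V → V → Bool) : Prop :=
  ∀ v, ¬ Relation.TransGen (fun a b => D a b = true) v v

/-- There is a directed walk (in an acyclic digraph: a directed path) with
exactly `k` arcs ending at `v`. -/
def pathEndB (D : V → V → Bool) : ℕ → V → Bool
  | 0, _ => true
  | k+1, v => decide (∃ u, D u v = true ∧ pathEndB D k u = true)

/-- The `k`-th level `L_k(D)`: the set of vertices `v` such that a longest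
directed path ending at `v` has exactly `k` arcs. -/
def level (D : V → V → Bool) (k : ℕ) : Finset V :=
  Finset.univ.filter fun v => pathEndB D k v = true ∧ pathEndB D (k+1) v = false

/-- One step of Bott equivalence on digraphs: a local complementation,
a slide, or a digraph isomorphism. -/
def BottStep (D H : V → V → Bool) : Prop :=
  (∃ v, H = localComp D v) ∨
  (∃ v w, v ≠ w ∧ inN D v = inN D w ∧ H = slide D v w) ∨
  (∃ e : Equiv.Perm V, ∀ a b, H a b = D (e a) (e b))

/-- Two digraphs are Bott equivalent if one is obtained from the other by a
finite sequence of local complementations, slides and isomorphisms. -/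
def BottEquiv (D H : V → V → Bool) : Prop :=
  Relation.ReflTransGen BottStep D H

/-- The adjacency matrix of a digraph, over `𝔽₂ = ZMod 2`. -/
def adjMat (D : V → V → Bool) : Matrix V V (ZMod 2) :=
  fun i j => if D i j = true then 1 else 0

/-- The transitive closure of a digraph contains every arc of its local complements. -/
theorem transGen_of_localComp {W : Type*} [DecidableEq W] {D : W → W → Bool} {v a b : W}
    (h : localComp D v a b = true) :
    Relation.TransGen (fun a b => D a b = true) a b := by
  unfold localComp at h
  split_ifs at h with hc
  · exact .tail (.single hc.2.1) hc.2.2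
  · exact .single h

/-- If `D` is an acyclic digraph and `v` is a vertex of `D`, then
the local complement `D*v` is also an acyclic digraph. -/
theorem localComp_isAcyclic (D : V → V → Bool) (hD : IsAcyclic D) (v : V) :
    IsAcyclic (localComp D v) := by
  intro u hu
  exact hD u (Relation.TransGen.closed (fun _ _ => transGen_of_localComp) _ _ hu)
end

section
/- If D is an acyclic digraph and v, w are distinct vertices with N⁻_D(v) = N⁻_D(w), then the slide D Δ vw is also an acyclic digraph. -/
/-!
Digraphs on a finite vertex set `V` are modelled as irreflexive relations,
encoded as functions `V → V → Bool`.
-/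

variable {V : Type*} [Fintype V] [DecidableEq V]

omit [DecidableEq V] in
/-- Vertices with equal in-neighborhoods are reached from the same vertices. -/
theorem transGen_of_inN_eq {D : V → V → Bool} {v w : V} (hin : inN D v = inN D w) {x : V}
    (h : Relation.TransGen (fun a b => D a b = true) x w) :
    Relation.TransGen (fun a b => D a b = true) x v := by
  have key : ∀ u, D u w = true → D u v = true := fun u hu => by
    have hmem : u ∈ inN D v := by rw [hin]; simpa [inN] using hu
    simpa [inN] using hmem
  cases h with
  | single h => exact .single (key _ h)
  | tail h₁ h₂ => exact h₁.tail (key _ h₂)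

omit [Fintype V] in
/-- An arc of the slide is an arc of `D`, or it starts at `w` and comes from an arc at `v`. -/
theorem arc_of_slide {D : V → V → Bool} {v w a b : V} (h : slide D v w a b = true) :
    D a b = true ∨ a = w ∧ D v b = true := by
  unfold slide at h
  grind

/-- A walk in the slide gives a walk in `D` with the same ends, except that one starting
at `w` may have to start at `v` instead. -/
theorem transGen_of_transGen_slide {D : V → V → Bool} {v w : V} (hin : inN D v = inN D w)
    {x y : V} (h : Relation.TransGen (fun a b => slide D v w a b = true) x y) :
    Relation.TransGen (fun a b => D a b = true) x y ∨
      x = w ∧ Relation.TransGen (fun a b => D a b = true) v y := by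
  induction h with
  | single h => exact (arc_of_slide h).imp .single (And.imp_right .single)
  | tail _ h ih =>
    rcases arc_of_slide h with hD | ⟨rfl, hv⟩
    · exact ih.imp (·.tail hD) (And.imp_right (·.tail hD))
    · exact ih.imp (fun p => (transGen_of_inN_eq hin p).tail hv)
        (And.imp_right fun p => (transGen_of_inN_eq hin p).tail hv)

/-- If `D` is an acyclic digraph and `v, w` are distinct vertices
with `N⁻_D(v) = N⁻_D(w)`, then the slide `D Δ vw` is also an acyclic digraph. -/
theorem slide_isAcyclic (D : V → V → Bool) (hD : IsAcyclic D) (v w : V)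
    (hvw : v ≠ w) (hin : inN D v = inN D w) :
    IsAcyclic (slide D v w) := by
  intro x hx
  rcases transGen_of_transGen_slide hin hx with h | ⟨rfl, h⟩
  · exact hD x h
  · exact hD v (transGen_of_inN_eq hin h)
end

section
/- The map A ↦ Iₙ + Aᵗ (over 𝔽₂) is a bijection from the set 𝒜ₙ of adjacency matrices of acyclic digraphs on the vertex set {1,…,n} onto the set M(n) of n×n matrices over 𝔽₂ all of whose principal minors are equal to 1. -/
/-!
Digraphs on a finite vertex set `V` are modelled as irreflexive relations,
encoded as functions `V → V → Bool`.
-/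

variable {V : Type*} [Fintype V] [DecidableEq V]

/-- If the off-diagonal support of a square matrix is contained in the reverse of a relation
without cycles, the determinant is the product of the diagonal entries. -/
theorem det_eq_prod_diag_of_acyclic {α R : Type*} [Fintype α] [DecidableEq α] [CommRing R]
    (r : α → α → Prop) (hr : ∀ v, ¬ Relation.TransGen r v v) (M : Matrix α α R)
    (hM : ∀ i j, M i j ≠ 0 → i = j ∨ r j i) : M.det = ∏ i, M i i := by
  rw [Matrix.det_apply, Finset.sum_eq_single 1]
  · simp
  · intro σ _ hσ
    obtain ⟨i, hi⟩ : ∃ i, σ i ≠ i := by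
      by_contra! h
      exact hσ (Equiv.ext h)
    suffices h : ∃ j, M (σ j) j = 0 by
      obtain ⟨j, hj⟩ := h
      have hprod : ∏ k, M (σ k) k = 0 :=
        Finset.prod_eq_zero (f := fun k => M (σ k) k) (Finset.mem_univ j) hj
      rw [hprod, smul_zero]
    by_contra! h
    have hstep : ∀ k : ℕ, r ((σ ^ k) i) ((σ ^ (k + 1)) i) := by
      intro k
      rw [pow_succ', Equiv.Perm.mul_apply]
      refine (hM _ _ (h ((σ ^ k) i))).resolve_left fun hk => hi ?_
      apply (σ ^ k).injective
      rw [← Equiv.Perm.mul_apply, ← pow_succ, pow_succ', Equiv.Perm.mul_apply, hk]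
    have hwalk : ∀ k : ℕ, Relation.TransGen r i ((σ ^ (k + 1)) i) := by
      intro k
      induction k with
      | zero => exact .single (by simpa using hstep 0)
      | succ k ih => exact ih.tail (hstep (k + 1))
    have hpos : 0 < orderOf σ := orderOf_pos σ
    have hw := hwalk (orderOf σ - 1)
    rw [Nat.sub_add_cancel hpos, pow_orderOf_eq_one] at hw
    exact hr i hw
  · simp

/-- A relation on a finite type that has a cycle induces, on some nonempty set, a relation in
which every element has exactly one successor. -/
theorem exists_finset_existsUnique_succ_of_cycle {α : Type*} [Finite α] (r : α → α → Prop)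
    {v : α} (hv : Relation.TransGen r v v) :
    ∃ S : Finset α, S.Nonempty ∧ ∀ x ∈ S, ∃! y, y ∈ S ∧ r x y := by
  classical
  have := Fintype.ofFinite α
  let P : Finset α → Prop := fun S => S.Nonempty ∧ ∀ x ∈ S, ∃ y ∈ S, r x y
  have hP : ∃ S, P S := by
    refine ⟨Finset.univ.filter fun x => Relation.TransGen r x v, ⟨v, by simpa using hv⟩, ?_⟩
    intro x hx
    simp only [Finset.mem_filter, Finset.mem_univ, true_and] at hx ⊢
    obtain ⟨y, hxy, hyv⟩ := Relation.TransGen.head'_iff.1 hx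
    rcases Relation.reflTransGen_iff_eq_or_transGen.1 hyv with rfl | hyv
    · exact ⟨_, hv, hxy⟩
    · exact ⟨y, hyv, hxy⟩
  obtain ⟨S, ⟨hne, hS⟩, hmin⟩ := exists_minimal_of_wellFoundedLT P hP
  have hsurj : ∀ f : α → α, (∀ x ∈ S, f x ∈ S ∧ r x (f x)) → S.image f = S := by
    intro f hf
    have hsub : S.image f ⊆ S := Finset.image_subset_iff.2 fun x hx => (hf x hx).1
    refine hsub.antisymm (hmin ⟨hne.image f, fun y hy => ?_⟩ hsub)
    exact ⟨f y, Finset.mem_image_of_mem f (hsub hy), (hf y (hsub hy)).2⟩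
  choose! f hf using hS
  refine ⟨S, hne, fun x hx => ⟨f x, hf x hx, fun y hy => ?_⟩⟩
  have hg : S.image (Function.update f x y) = S := by
    refine hsurj _ fun z hz => ?_
    rcases eq_or_ne z x with rfl | hzx
    · simpa using hy
    · simpa [hzx] using hf z hz
  have hinj := Finset.injOn_of_card_image_eq (congrArg Finset.card hg)
  have hy' : y ∈ S.image f := by rw [hsurj f hf]; exact hy.1
  obtain ⟨z, hz, rfl⟩ := Finset.mem_image.1 hy'
  rcases eq_or_ne z x with rfl | hzx
  · rfl
  · exact absurd (hinj hz hx (by simp [hzx])) hzx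

/-- If all principal minors of `1 + Aᵗ` over `𝔽₂` are `1`, where `A` is the adjacency matrix of
the digraph `D`, then `D` is acyclic. -/
theorem isAcyclic_of_principal_minors_eq_one {α : Type*} [Fintype α] [DecidableEq α]
    (D : α → α → Bool)
    (h : ∀ S : Finset α, ((1 + (adjMat D).transpose).submatrix
      (fun i : {x // x ∈ S} => (i : α)) (fun j : {x // x ∈ S} => (j : α))).det = 1) :
    IsAcyclic D := by
  intro v hv
  obtain ⟨S, ⟨s, hs⟩, hS⟩ := exists_finset_existsUnique_succ_of_cycle _ hv
  refine one_ne_zero ((h S).symm.trans ?_)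
  refine Matrix.exists_vecMul_eq_zero_iff.1 ⟨fun _ => 1, fun h0 => ?_, ?_⟩
  · exact one_ne_zero (congrFun h0 ⟨s, hs⟩)
  · funext j
    obtain ⟨y, ⟨hyS, hy⟩, huniq⟩ := hS j j.2
    have hA : ∑ x : {x // x ∈ S}, adjMat D j x = 1 := by
      rw [Finset.sum_eq_single ⟨y, hyS⟩]
      · simp [adjMat, hy]
      · intro x _ hx
        exact if_neg fun hD => hx (Subtype.ext (huniq x ⟨x.2, hD⟩))
      · simp
    have hI : ∑ x : {x // x ∈ S}, (1 : Matrix α α (ZMod 2)) x j = 1 := by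
      simp [Matrix.one_apply]
    simp only [Matrix.vecMul, dotProduct, Matrix.submatrix_apply, Matrix.add_apply,
      Matrix.transpose_apply, one_mul, Finset.sum_add_distrib, hA, hI, Pi.zero_apply]
    rfl

open Matrix in
/-- The map `A ↦ Iₙ + Aᵗ` (over `𝔽₂`) is a bijection from the set
`𝒜ₙ` of adjacency matrices of acyclic digraphs on `{1,…,n}` onto the set `M(n)`
of `n × n` matrices over `𝔽₂` all of whose principal minors are `1`. -/
theorem adjMat_bijOn (n : ℕ) :
    Set.BijOn (fun A : Matrix (Fin n) (Fin n) (ZMod 2) => 1 + Aᵀ)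
      {A | ∃ D : Fin n → Fin n → Bool, IsAcyclic D ∧ A = adjMat D}
      {B | ∀ S : Finset (Fin n),
        (B.submatrix (fun i : {x // x ∈ S} => (i : Fin n))
          (fun j : {x // x ∈ S} => (j : Fin n))).det = 1} := by
  refine ⟨?_, fun A _ A' _ h => Matrix.transpose_injective (add_left_cancel h), fun B hB => ?_⟩
  · rintro _ ⟨D, hD, rfl⟩ S
    have hdiag : ∀ i, D i i = false := fun i =>
      Bool.eq_false_iff.2 fun hi => hD i (.single hi)
    rw [det_eq_prod_diag_of_acyclic (fun a b : {x // x ∈ S} => D a b = true)]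
    · simp [adjMat, hdiag]
    · exact fun v hv => hD v (hv.lift Subtype.val fun _ _ h => h)
    · intro i j hij
      by_contra! h
      exact hij (by simp [adjMat, h.1, h.2])
  · have hdiag : ∀ i, B i i = 1 := by
      intro i
      have hi := hB {i}
      rw [Matrix.det_eq_elem_of_subsingleton _ (⟨i, Finset.mem_singleton_self i⟩ :
        {x // x ∈ ({i} : Finset (Fin n))})] at hi
      exact hi
    let D : Fin n → Fin n → Bool := fun i j => decide (i ≠ j ∧ B j i = 1)
    have hDB : 1 + (adjMat D)ᵀ = B := by
      ext i j
      rcases eq_or_ne i j with rfl | hij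
      · simp [adjMat, D, hdiag]
      · rcases (by decide : ∀ x : ZMod 2, x = 0 ∨ x = 1) (B i j) with h | h <;>
          simp [adjMat, D, h, hij, hij.symm]
    exact ⟨adjMat D, ⟨D, isAcyclic_of_principal_minors_eq_one D (hDB ▸ hB), rfl⟩, hDB⟩
end

section
/- Two acyclic digraphs on the vertex set {1,…,n} are Bott equivalent if and only if their adjacency matrices are Bott equivalent (as matrices, via the operations Φ_S, Φᵏ, Φ^I_C). -/
/-!
Digraphs on a finite vertex set `V` are modelled as irreflexive relations,
encoded as functions `V → V → Bool`.
-/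

variable {V : Type*} [Fintype V] [DecidableEq V]

/-- Masuda's operation `Φᵏ`: `Φᵏ(A)_j = A_j + A^k_j · A_k` for every column
index `j`, i.e. entrywise `Φᵏ(A)^i_j = A^i_j + A^k_j · A^i_k`. -/
def PhiK (k : V) (A : Matrix V V (ZMod 2)) : Matrix V V (ZMod 2) :=
  fun i j => A i j + A k j * A i k

/-- Masuda's operation `Φ^I_C`: the submatrix of `A` formed by the rows indexed
by `I` is replaced by `C` times that submatrix; other rows are unchanged. -/
def PhiIC (I : Finset V) (C : Matrix {x // x ∈ I} {x // x ∈ I} (ZMod 2))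
    (A : Matrix V V (ZMod 2)) : Matrix V V (ZMod 2) :=
  fun i j => if h : i ∈ I then ∑ k : {x // x ∈ I}, C ⟨i, h⟩ k * A (k : V) j
    else A i j

/-- One step of Bott equivalence on matrices: conjugation by a permutation
matrix (`Φ_S`), a `Φᵏ`, or a `Φ^I_C` where the columns of `A` indexed by `I` are
pairwise equal and `C` is invertible. -/
def MBottStep (A B : Matrix V V (ZMod 2)) : Prop :=
  (∃ σ : Equiv.Perm V, ∀ i j, B i j = A (σ i) (σ j)) ∨
  (∃ k : V, B = PhiK k A) ∨
  (∃ I : Finset V, ∃ C : Matrix {x // x ∈ I} {x // x ∈ I} (ZMod 2),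
    IsUnit C ∧ (∀ i ∈ I, ∀ j ∈ I, ∀ r, A r i = A r j) ∧ B = PhiIC I C A)

/-- Two matrices are Bott equivalent if one is transformed to the other by a
finite sequence of the three operations `Φ_S`, `Φᵏ`, `Φ^I_C`. -/
def MBottEquiv (A B : Matrix V V (ZMod 2)) : Prop :=
  Relation.ReflTransGen MBottStep A B

/-- Arcs leaving any vertex with the same in-neighborhood as `a`. -/
def twinArc (D : V → V → Bool) (a b : V) : Prop :=
  ∃ a', inN D a' = inN D a ∧ D a' b = true

omit [DecidableEq V] in
lemma inN_eq_iff {D : V → V → Bool} {v w : V} :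
    inN D v = inN D w ↔ ∀ r, D r v = D r w := by
  simp only [inN, Finset.ext_iff, Finset.mem_filter, Finset.mem_univ, true_and]
  exact forall_congr' fun r => Bool.eq_iff_iff.symm

omit [DecidableEq V] in
lemma transGen_of_transGen_twinArc {D : V → V → Bool} {a b : V}
    (h : Relation.TransGen (twinArc D) a b) :
    ∃ a', inN D a' = inN D a ∧ Relation.TransGen (fun x y => D x y = true) a' b := by
  induction h with
  | single h =>
    obtain ⟨a', h₁, h₂⟩ := h
    exact ⟨a', h₁, .single h₂⟩
  | tail _ h ih =>
    obtain ⟨a', h₁, h₂⟩ := ih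
    obtain ⟨b', h₃, h₄⟩ := h
    refine ⟨a', h₁, .tail ?_ h₄⟩
    obtain ⟨x, hx, hxb⟩ := Relation.TransGen.tail'_iff.1 h₂
    exact .tail' hx ((inN_eq_iff.1 h₃ x).trans hxb)

omit [DecidableEq V] in
lemma IsAcyclic.of_twinArc {D H : V → V → Bool} (hD : IsAcyclic D)
    (hH : ∀ a b, H a b = true → Relation.TransGen (twinArc D) a b) : IsAcyclic H := by
  intro v hv
  obtain ⟨a, ha, h⟩ := transGen_of_transGen_twinArc (Relation.TransGen.closed hH v v hv)
  obtain ⟨x, hx, hxv⟩ := Relation.TransGen.tail'_iff.1 h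
  exact hD a (.tail' hx ((inN_eq_iff.1 ha x).trans hxv))

lemma IsAcyclic.bottStep {D H : V → V → Bool} (hD : IsAcyclic D) (h : BottStep D H) :
    IsAcyclic H := by
  rcases h with ⟨v, rfl⟩ | ⟨v, w, -, hvw, rfl⟩ | ⟨e, he⟩
  · refine hD.of_twinArc fun a b hab => ?_
    have harc {x y : V} (h : D x y = true) : twinArc D x y := ⟨x, rfl, h⟩
    unfold localComp at hab
    split_ifs at hab with h
    · exact .tail (.single (harc h.2.1)) (harc h.2.2)
    · exact .single (harc hab)
  · refine hD.of_twinArc fun a b hab => .single ?_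
    unfold slide at hab
    split_ifs at hab with h
    · subst h
      cases hab' : D a b
      · rw [hab', Bool.false_xor] at hab
        exact ⟨v, hvw, hab⟩
      · exact ⟨a, rfl, hab'⟩
    · exact ⟨a, rfl, hab⟩
  · intro v hv
    exact hD (e v) (hv.lift (p := fun a b => D a b = true) e fun a b hab => (he a b).symm.trans hab)

lemma IsAcyclic.bottEquiv {D H : V → V → Bool} (hD : IsAcyclic D) (h : BottEquiv D H) :
    IsAcyclic H := by
  induction h with
  | refl => exact hD
  | tail _ h ih => exact ih.bottStep h

omit [Fintype V] [DecidableEq V] in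
lemma adjMat_injective : Function.Injective (adjMat : (V → V → Bool) → Matrix V V (ZMod 2)) := by
  intro D H h
  ext a b
  have := congrFun (congrFun h a) b
  simp only [adjMat] at this
  cases h₁ : D a b <;> cases h₂ : H a b <;> simp_all

omit [DecidableEq V] in
lemma inN_eq_iff_adjMat {D : V → V → Bool} {v w : V} :
    inN D v = inN D w ↔ ∀ r, adjMat D r v = adjMat D r w := by
  refine inN_eq_iff.trans (forall_congr' fun r => ?_)
  cases h₁ : D r v <;> cases h₂ : D r w <;> simp [adjMat, h₁, h₂]

omit [Fintype V] in
lemma IsAcyclic.adjMat_localComp {D : V → V → Bool} (hD : IsAcyclic D) (v : V) :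
    adjMat (localComp D v) = PhiK v (adjMat D) := by
  ext i j
  have hne : D i v = true → D v j = true → i ≠ j := by
    rintro h₁ h₂ rfl
    exact hD i (.tail (.single h₁) h₂)
  cases h₁ : D i v <;> cases h₂ : D v j <;> cases h₃ : D i j <;>
    simp_all [adjMat, localComp, PhiK]
  decide

omit [Fintype V] in
lemma PhiIC_apply_mem {I : Finset V} (C : Matrix {x // x ∈ I} {x // x ∈ I} (ZMod 2))
    (A : Matrix V V (ZMod 2)) {i : V} (hi : i ∈ I) (j : V) :
    PhiIC I C A i j = (C * A.submatrix (Subtype.val : {x // x ∈ I} → V) id) ⟨i, hi⟩ j := by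
  simp [PhiIC, hi, Matrix.mul_apply]

omit [Fintype V] in
lemma PhiIC_apply_notMem {I : Finset V} (C : Matrix {x // x ∈ I} {x // x ∈ I} (ZMod 2))
    (A : Matrix V V (ZMod 2)) {i : V} (hi : i ∉ I) (j : V) :
    PhiIC I C A i j = A i j := by
  simp [PhiIC, hi]

omit [Fintype V] in
lemma PhiIC_one (I : Finset V) (A : Matrix V V (ZMod 2)) : PhiIC I 1 A = A := by
  ext i j
  by_cases hi : i ∈ I
  · rw [PhiIC_apply_mem _ _ hi, Matrix.one_mul, Matrix.submatrix_apply, id]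
  · exact PhiIC_apply_notMem _ _ hi j

omit [Fintype V] in
lemma PhiIC_mul (I : Finset V) (C C' : Matrix {x // x ∈ I} {x // x ∈ I} (ZMod 2))
    (A : Matrix V V (ZMod 2)) : PhiIC I (C * C') A = PhiIC I C (PhiIC I C' A) := by
  have hsub : (PhiIC I C' A).submatrix (Subtype.val : {x // x ∈ I} → V) id =
      C' * A.submatrix (Subtype.val : {x // x ∈ I} → V) id := by
    ext k j
    exact PhiIC_apply_mem C' A k.2 j
  ext i j
  by_cases hi : i ∈ I
  · rw [PhiIC_apply_mem _ _ hi, PhiIC_apply_mem _ _ hi, hsub, Matrix.mul_assoc]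
  · simp only [PhiIC_apply_notMem _ _ hi]

omit [Fintype V] in
lemma PhiIC_col_eq {I : Finset V} (C : Matrix {x // x ∈ I} {x // x ∈ I} (ZMod 2))
    {A : Matrix V V (ZMod 2)} {i j : V} (h : ∀ r, A r i = A r j) (r : V) :
    PhiIC I C A r i = PhiIC I C A r j := by
  simp only [PhiIC, h]

omit [Fintype V] in
lemma adjMat_slide {I : Finset V} (D : V → V → Bool) (v w : {x // x ∈ I}) :
    adjMat (slide D v w) = PhiIC I (Matrix.transvection w v 1) (adjMat D) := by
  ext i j
  by_cases hi : i ∈ I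
  · rw [PhiIC_apply_mem _ _ hi]
    by_cases hw : (⟨i, hi⟩ : {x // x ∈ I}) = w
    · subst hw
      rw [Matrix.transvection_mul_apply_same]
      cases h₁ : D i j <;> cases h₂ : D v j <;> simp [adjMat, slide, h₁, h₂]
      decide
    · rw [Matrix.transvection_mul_apply_of_ne _ _ _ _ hw]
      have hw' : i ≠ w := fun h => hw (Subtype.ext h)
      simp [adjMat, slide, hw']
  · have hw : i ≠ w := fun h => hi (h ▸ w.2)
    rw [PhiIC_apply_notMem _ _ hi]
    simp [adjMat, slide, hw]

lemma IsAcyclic.mBottStep {D H : V → V → Bool} (hD : IsAcyclic D) (h : BottStep D H) :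
    MBottStep (adjMat D) (adjMat H) := by
  rcases h with ⟨v, rfl⟩ | ⟨v, w, hne, hvw, rfl⟩ | ⟨e, he⟩
  · exact .inr (.inl ⟨v, hD.adjMat_localComp v⟩)
  · refine .inr (.inr ⟨{v, w}, Matrix.transvection ⟨w, by simp⟩ ⟨v, by simp⟩ 1, ?_, ?_,
      adjMat_slide D ⟨v, by simp⟩ ⟨w, by simp⟩⟩)
    · rw [Matrix.isUnit_iff_isUnit_det, Matrix.det_transvection_of_ne _ _ (by simpa using hne.symm)]
      exact isUnit_one
    · have hcol := inN_eq_iff_adjMat.1 hvw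
      intro i hi j hj r
      simp only [Finset.mem_insert, Finset.mem_singleton] at hi hj
      rcases hi with rfl | rfl <;> rcases hj with rfl | rfl <;> simp [hcol]
  · exact .inl ⟨e, fun i j => by simp [adjMat, he]⟩

lemma exists_bottEquiv_adjMat_eq_PhiIC {I : Finset V}
    {C : Matrix {x // x ∈ I} {x // x ∈ I} (ZMod 2)} (hC : IsUnit C) (D : V → V → Bool)
    (hcol : ∀ i ∈ I, ∀ j ∈ I, ∀ r, adjMat D r i = adjMat D r j) :
    ∃ H, BottEquiv D H ∧ adjMat H = PhiIC I C (adjMat D) := by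
  have zmod_two_eq_one : ∀ x : ZMod 2, x ≠ 0 → x = 1 := by decide
  refine Matrix.diagonal_transvection_induction_of_det_ne_zero
    (fun C => ∀ D : V → V → Bool, (∀ i ∈ I, ∀ j ∈ I, ∀ r, adjMat D r i = adjMat D r j) →
      ∃ H, BottEquiv D H ∧ adjMat H = PhiIC I C (adjMat D))
    C ((Matrix.isUnit_iff_isUnit_det C).1 hC).ne_zero ?_ ?_ ?_ D hcol
  · intro d hd D _
    rw [Matrix.det_diagonal, Finset.prod_ne_zero_iff] at hd
    obtain rfl : d = 1 := funext fun i => zmod_two_eq_one _ (hd i (Finset.mem_univ i))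
    exact ⟨D, .refl, (PhiIC_one I _).symm.trans (by rw [← Matrix.diagonal_one]; rfl)⟩
  · intro t D hcol
    by_cases hc : t.c = 0
    · refine ⟨D, .refl, ?_⟩
      rw [Matrix.TransvectionStruct.toMatrix, hc, Matrix.transvection_zero, PhiIC_one]
    · refine ⟨slide D t.j t.i, .single (.inr (.inl ⟨t.j, t.i, ?_, ?_, rfl⟩)), ?_⟩
      · exact fun h => t.hij (Subtype.ext h.symm)
      · exact inN_eq_iff_adjMat.2 (hcol _ t.j.2 _ t.i.2)
      · rw [Matrix.TransvectionStruct.toMatrix, zmod_two_eq_one _ hc, adjMat_slide]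
  · intro A B _ _ ihA ihB D hcol
    obtain ⟨H, hDH, hH⟩ := ihB D hcol
    obtain ⟨K, hHK, hK⟩ := ihA H fun i hi j hj => by
      rw [hH]
      exact PhiIC_col_eq B (hcol i hi j hj)
    exact ⟨K, hDH.trans hHK, by rw [hK, hH, PhiIC_mul]⟩

lemma IsAcyclic.exists_bottEquiv_of_mBottStep {D : V → V → Bool} (hD : IsAcyclic D)
    {B : Matrix V V (ZMod 2)} (h : MBottStep (adjMat D) B) :
    ∃ H, BottEquiv D H ∧ adjMat H = B := by
  rcases h with ⟨e, he⟩ | ⟨v, rfl⟩ | ⟨I, C, hC, hcol, rfl⟩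
  · refine ⟨fun a b => D (e a) (e b), .single (.inr (.inr ⟨e, fun _ _ => rfl⟩)), ?_⟩
    ext i j
    rw [he]
    rfl
  · exact ⟨localComp D v, .single (.inl ⟨v, rfl⟩), hD.adjMat_localComp v⟩
  · exact exists_bottEquiv_adjMat_eq_PhiIC hC D hcol

lemma IsAcyclic.exists_bottEquiv_of_mBottEquiv {D : V → V → Bool} (hD : IsAcyclic D)
    {B : Matrix V V (ZMod 2)} (h : MBottEquiv (adjMat D) B) :
    ∃ H, BottEquiv D H ∧ adjMat H = B := by
  induction h with
  | refl => exact ⟨D, .refl, rfl⟩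
  | tail _ h ih =>
    obtain ⟨H, hDH, rfl⟩ := ih
    obtain ⟨K, hHK, hK⟩ := (hD.bottEquiv hDH).exists_bottEquiv_of_mBottStep h
    exact ⟨K, hDH.trans hHK, hK⟩

lemma IsAcyclic.mBottEquiv {D H : V → V → Bool} (hD : IsAcyclic D) (h : BottEquiv D H) :
    MBottEquiv (adjMat D) (adjMat H) := by
  induction h with
  | refl => exact .refl
  | tail hDH h ih => exact ih.tail ((hD.bottEquiv hDH).mBottStep h)

/-- Two acyclic digraphs on `{1,…,n}` are Bott equivalent if and
only if their adjacency matrices are Bott equivalent (via `Φ_S`, `Φᵏ`, `Φ^I_C`). -/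
theorem bottEquiv_iff_mBottEquiv (n : ℕ) (D H : Fin n → Fin n → Bool)
    (hD : IsAcyclic D) (hH : IsAcyclic H) :
    BottEquiv D H ↔ MBottEquiv (adjMat D) (adjMat H) := by
  refine ⟨hD.mBottEquiv, fun h => ?_⟩
  obtain ⟨K, hDK, hK⟩ := hD.exists_bottEquiv_of_mBottEquiv h
  exact adjMat_injective hK ▸ hDK
end

section
/- For every acyclic digraph D, every vertex w of D, and every k, the k-th level of the local complement equals the k-th level of D: L_k(D*w) = L_k(D). -/
/-!
Digraphs on a finite vertex set `V` are modelled as irreflexive relations,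
encoded as functions `V → V → Bool`.
-/

variable {V : Type*} [Fintype V] [DecidableEq V]

omit [DecidableEq V] in
theorem pathEndB_succ_iff (D : V → V → Bool) (k : ℕ) (v : V) :
    pathEndB D (k + 1) v = true ↔ ∃ u, D u v = true ∧ pathEndB D k u = true := by
  simp [pathEndB]

omit [DecidableEq V] in
theorem pathEndB_of_succ (D : V → V → Bool) (k : ℕ) (v : V)
    (h : pathEndB D (k + 1) v = true) : pathEndB D k v = true := by
  induction k generalizing v with
  | zero => rfl
  | succ k ih =>
    obtain ⟨u, huv, hu⟩ := (pathEndB_succ_iff D (k + 1) v).1 h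
    exact (pathEndB_succ_iff D k v).2 ⟨u, huv, ih u hu⟩

omit [DecidableEq V] in
/-- If every arc of `H` is an arc of `D` or joins the ends of a two-arc walk of `D`, then the
walks of `D` ending at a vertex are at least as long as those of `H`. -/
theorem pathEndB_of_forall_arc {D H : V → V → Bool}
    (hDH : ∀ u v, H u v = true → D u v = true ∨ ∃ w, D u w = true ∧ D w v = true)
    (k : ℕ) (v : V) (h : pathEndB H k v = true) : pathEndB D k v = true := by
  induction k generalizing v with
  | zero => rfl
  | succ k ih =>
    obtain ⟨u, huv, hu⟩ := (pathEndB_succ_iff H k v).1 h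
    rcases hDH u v huv with huv' | ⟨w, huw, hwv⟩
    · exact (pathEndB_succ_iff D k v).2 ⟨u, huv', ih u hu⟩
    · refine pathEndB_of_succ D (k + 1) v ((pathEndB_succ_iff D (k + 1) v).2 ⟨w, hwv, ?_⟩)
      exact (pathEndB_succ_iff D k w).2 ⟨u, huw, ih u hu⟩

omit [Fintype V] in
theorem arc_or_of_localComp (D : V → V → Bool) (w u v : V) (h : localComp D w u v = true) :
    D u v = true ∨ ∃ x, D u x = true ∧ D x v = true := by
  unfold localComp at h
  split_ifs at h with hc
  · exact Or.inr ⟨w, hc.2⟩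
  · exact Or.inl h

omit [Fintype V] in
/-- Local complementation at a loopless vertex is an involution. -/
theorem localComp_localComp (D : V → V → Bool) {w : V} (hw : ¬ D w w = true) :
    localComp (localComp D w) w = D := by
  funext u v
  have hww : D w w = false := Bool.eq_false_iff.2 hw
  by_cases h : u ≠ v ∧ D u w = true ∧ D w v = true <;> simp [localComp, hww, h]

theorem pathEndB_localComp (D : V → V → Bool) {w : V} (hw : ¬ D w w = true) (k : ℕ) (v : V) :
    pathEndB (localComp D w) k v = pathEndB D k v := by
  refine Bool.eq_iff_iff.2 ⟨pathEndB_of_forall_arc (arc_or_of_localComp D w) k v, ?_⟩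
  refine pathEndB_of_forall_arc (fun a b hab => arc_or_of_localComp (localComp D w) w a b ?_) k v
  rwa [localComp_localComp D hw]

/-- For every acyclic digraph `D`, every vertex `w` and every `k`,
the `k`-th level of the local complement equals the `k`-th level of `D`:
`L_k(D*w) = L_k(D)`. -/
theorem level_localComp (D : V → V → Bool) (hD : IsAcyclic D) (w : V) (k : ℕ) :
    level (localComp D w) k = level D k := by
  have hw : ¬ D w w = true := fun h => hD w (.single h)
  simp only [level, pathEndB_localComp D hw]
end

section
/- Bott equivalent acyclic digraphs have the same rank, i.e., if acyclic digraphs D and H on {1,…,n} are Bott equivalent, then the adjacency matrices A_D and A_H have the same rank over 𝔽₂. -/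
/-!
Digraphs on a finite vertex set `V` are modelled as irreflexive relations,
encoded as functions `V → V → Bool`.
-/

variable {V : Type*} [Fintype V] [DecidableEq V]

/-- Adding multiples of row `v` to the other rows does not change the rank. -/
theorem Matrix.rank_eq_of_add_smul_row {K : Type*} [Field K] (A B : Matrix V V K) (v : V)
    (c : V → K) (hc : c v = 0) (h : ∀ i j, B i j = A i j + c i * A v j) :
    B.rank = A.rank := by
  have hB : B = (1 + Matrix.vecMulVec c (Pi.single v 1)) * A := by
    ext i j
    simp [Matrix.add_mul, Matrix.vecMulVec_mul, Matrix.vecMulVec_apply, h]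
  rw [hB]
  apply Matrix.rank_mul_eq_right_of_isUnit_det
  rw [Matrix.vecMulVec_eq Unit, Matrix.det_one_add_replicateCol_mul_replicateRow]
  simp [hc]

/-- A height function for `D` increases along every arc. -/
def IsHeight (D : V → V → Bool) (f : V → ℕ) : Prop :=
  ∀ a b, D a b = true → f a < f b

theorem IsAcyclic.exists_isHeight {α : Type*} [Fintype α] {D : α → α → Bool} (hD : IsAcyclic D) :
    ∃ f, IsHeight D f := by
  classical
  refine ⟨fun x => (Finset.univ.filter fun y =>
    Relation.TransGen (fun a b => D a b = true) y x).card, fun a b hab => ?_⟩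
  apply Finset.card_lt_card
  rw [Finset.ssubset_iff_of_subset]
  · exact ⟨a, Finset.mem_filter.mpr ⟨Finset.mem_univ a, .single hab⟩,
      fun ha => hD a (Finset.mem_filter.mp ha).2⟩
  · intro y hy
    simp only [Finset.mem_filter, Finset.mem_univ, true_and] at hy ⊢
    exact hy.tail hab

theorem IsHeight.localComp {α : Type*} [DecidableEq α] {D : α → α → Bool} {f : α → ℕ}
    (hf : IsHeight D f) (v : α) :
    IsHeight (localComp D v) f := by
  intro a b hab
  unfold _root_.localComp at hab
  split_ifs at hab with h
  · exact (hf a v h.2.1).trans (hf v b h.2.2)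
  · exact hf a b hab

theorem eq_of_inN_eq {α : Type*} [Fintype α] {D : α → α → Bool} {v w : α}
    (h : inN D v = inN D w) (u : α) :
    D u v = D u w := by
  have := congrArg (u ∈ ·) h
  rw [Bool.eq_iff_iff]
  simpa only [inN, Finset.mem_filter, Finset.mem_univ, true_and, eq_iff_iff] using this

/-- Lowering `v` and `w` to their common minimum gives a height function for the slide. -/
theorem IsHeight.slide {D : V → V → Bool} {f : V → ℕ} (hf : IsHeight D f) {v w : V}
    (h : inN D v = inN D w) :
    IsHeight (slide D v w) fun x => if x = v ∨ x = w then min (f v) (f w) else f x := by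
  have hin := eq_of_inN_eq h
  have hirr : ∀ a, D a a = false := fun a => by
    by_contra ha
    exact (hf a a (by simpa using ha)).false
  intro a b hab
  unfold _root_.slide at hab
  have key : D a b = true ∨ a = w ∧ D v b = true := by
    split_ifs at hab with haw
    · subst haw
      cases hb : D a b <;> simp_all
    · exact Or.inl hab
  have := hin a
  have := hin v
  have := hin w
  have := hirr v
  have := hirr w
  have := hf a b
  have := hf a v
  have := hf a w
  have := hf v b
  grind

theorem BottStep.exists_isHeight {D H : V → V → Bool} (h : BottStep D H)
    (hD : ∃ f, IsHeight D f) : ∃ f, IsHeight H f := by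
  obtain ⟨f, hf⟩ := hD
  rcases h with ⟨v, rfl⟩ | ⟨v, w, -, hin, rfl⟩ | ⟨e, he⟩
  · exact ⟨f, hf.localComp v⟩
  · exact ⟨_, hf.slide hin⟩
  · exact ⟨f ∘ e, fun a b hab => hf _ _ (he a b ▸ hab)⟩

theorem IsHeight.rank_localComp {D : V → V → Bool} {f : V → ℕ} (hf : IsHeight D f) (v : V) :
    (adjMat (_root_.localComp D v)).rank = (adjMat D).rank := by
  refine Matrix.rank_eq_of_add_smul_row _ _ v (fun u => adjMat D u v) ?_ fun i j => ?_
  · have := hf v v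
    simp_all [adjMat]
  · have hij : ¬ (i = j ∧ D i v = true ∧ D v j = true) := by
      rintro ⟨rfl, h₁, h₂⟩
      exact (hf _ _ h₁).asymm (hf _ _ h₂)
    cases h₁ : D i v <;> cases h₂ : D v j <;> cases h₃ : D i j <;>
      simp_all [adjMat, _root_.localComp] <;> decide

theorem rank_slide (D : V → V → Bool) {v w : V} (hvw : v ≠ w) :
    (adjMat (slide D v w)).rank = (adjMat D).rank := by
  refine Matrix.rank_eq_of_add_smul_row _ _ v (fun u => if u = w then 1 else 0) ?_ fun i j => ?_
  · simp [hvw]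
  · by_cases hi : i = w
    · subst hi
      cases h₁ : D i j <;> cases h₂ : D v j <;> simp [adjMat, slide, h₁, h₂] <;> decide
    · simp [adjMat, slide, hi]

theorem BottStep.rank_eq {D H : V → V → Bool} (h : BottStep D H) (hD : ∃ f, IsHeight D f) :
    (adjMat H).rank = (adjMat D).rank := by
  obtain ⟨f, hf⟩ := hD
  rcases h with ⟨v, rfl⟩ | ⟨v, w, hvw, -, rfl⟩ | ⟨e, he⟩
  · exact hf.rank_localComp v
  · exact rank_slide D hvw
  · have : adjMat H = (adjMat D).submatrix e e := by
      ext a b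
      simp [adjMat, he]
    rw [this, Matrix.rank_submatrix]

/-- Bott equivalent acyclic digraphs have the same rank: if
acyclic digraphs `D` and `H` on `{1,…,n}` are Bott equivalent, then `A_D` and
`A_H` have the same rank over `𝔽₂`. -/
theorem rank_bottEquiv (n : ℕ) (D H : Fin n → Fin n → Bool)
    (hD : IsAcyclic D) (hH : IsAcyclic H) (hBE : BottEquiv D H) :
    (adjMat D).rank = (adjMat H).rank := by
  suffices h : (∃ f, IsHeight H f) ∧ (adjMat D).rank = (adjMat H).rank from h.2
  clear hH
  induction hBE with
  | refl => exact ⟨hD.exists_isHeight, rfl⟩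
  | tail _ hstep ih => exact ⟨hstep.exists_isHeight ih.1, ih.2.trans (hstep.rank_eq ih.1).symm⟩
end

section
/- For every acyclic digraph D on {1,…,n} and every vertex v, adding the row of v of A_D to the rows of all in-neighbors of v yields the adjacency matrix A_{D*v}; in particular rank(A_{D*v}) = rank(A_D) over 𝔽₂. Similarly, for distinct vertices u, w with N⁻_D(u) = N⁻_D(w), rank(A_{D Δ uw}) = rank(A_D). -/
/-!
Digraphs on a finite vertex set `V` are modelled as irreflexive relations,
encoded as functions `V → V → Bool`.
-/

variable {V : Type*} [Fintype V] [DecidableEq V]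

/-- Adding multiples of the row `v` to other rows does not change the rank of a matrix. -/
theorem Matrix.rank_eq_of_add_mul_row {m k R : Type*} [Fintype m] [DecidableEq m] [Fintype k]
    [CommRing R] {A B : Matrix m k R} {c : m → R} {v : m} (hc : c v = 0)
    (h : ∀ i j, B i j = A i j + c i * A v j) : B.rank = A.rank := by
  set P : Matrix m m R :=
    1 + Matrix.replicateCol Unit c * Matrix.replicateRow Unit (Pi.single v (1 : R)) with hP
  have hdet : P.det = 1 := by
    rw [hP, Matrix.det_one_add_replicateCol_mul_replicateRow]
    simp [hc]
  have hB : B = P * A := by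
    ext i j
    rw [h, hP, Matrix.add_mul, Matrix.one_mul, Matrix.mul_assoc]
    simp [Matrix.mul_apply, Pi.single_apply]
  rw [hB, Matrix.rank_mul_eq_right_of_isUnit_det P A (by simp [hdet])]

theorem IsAcyclic.not_arc_self {V : Type*} {D : V → V → Bool} (hD : IsAcyclic D) (v : V) :
    D v v = false :=
  Bool.eq_false_iff.2 fun h => hD v (.single h)

theorem IsAcyclic.not_arc_symm {V : Type*} {D : V → V → Bool} (hD : IsAcyclic D) {u v : V}
    (h : D u v = true) : D v u = false :=
  Bool.eq_false_iff.2 fun h' => hD u (.tail (.single h) h')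

/-- In an acyclic digraph, local complementation at `v` adds the row of `v` to the rows of all
in-neighbors of `v`. -/
theorem adjMat_localComp_apply {V : Type*} [DecidableEq V] {D : V → V → Bool}
    (hD : IsAcyclic D) (v i j : V) :
    adjMat (localComp D v) i j =
      adjMat D i j + (if D i v = true then adjMat D v j else 0) := by
  have two : (1 : ZMod 2) + 1 = 0 := by decide
  by_cases hiv : D i v = true
  · by_cases hij : i = j
    · subst hij
      simp [adjMat, localComp, hD.not_arc_symm hiv]
    · cases hvj : D v j <;> cases hDij : D i j <;>
        simp [adjMat, localComp, hiv, hij, hvj, hDij, two]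
  · simp [adjMat, localComp, hiv]

/-- The slide along `u, w` adds the row of `u` to the row of `w`. -/
theorem adjMat_slide_apply {V : Type*} [DecidableEq V] (D : V → V → Bool) (u w i j : V) :
    adjMat (slide D u w) i j =
      adjMat D i j + (if i = w then 1 else 0) * adjMat D u j := by
  have two : (1 : ZMod 2) + 1 = 0 := by decide
  by_cases hi : i = w
  · subst hi
    cases hu : D u j <;> cases hw : D i j <;> simp [adjMat, slide, hu, hw, two]
  · simp [adjMat, slide, hi]

/-- For every acyclic digraph `D` on `{1,…,n}` and every vertex
`v`, adding the row of `v` of `A_D` to the rows of all in-neighbors of `v`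
yields `A_{D*v}`; in particular `rank(A_{D*v}) = rank(A_D)` over `𝔽₂`.
Similarly, for distinct `u, w` with `N⁻_D(u) = N⁻_D(w)`,
`rank(A_{D Δ uw}) = rank(A_D)`. -/
theorem rank_localComp_slide (n : ℕ) (D : Fin n → Fin n → Bool)
    (hD : IsAcyclic D) :
    (∀ v : Fin n,
      (∀ i j, adjMat (localComp D v) i j =
        adjMat D i j + (if D i v = true then adjMat D v j else 0)) ∧
      (adjMat (localComp D v)).rank = (adjMat D).rank) ∧
    (∀ u w : Fin n, u ≠ w → inN D u = inN D w →
      (adjMat (slide D u w)).rank = (adjMat D).rank) := by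
  refine ⟨fun v => ⟨adjMat_localComp_apply hD v, ?_⟩, fun u w huw _ => ?_⟩
  · refine Matrix.rank_eq_of_add_mul_row (c := fun i => if D i v = true then 1 else 0) (v := v)
      (by simp [hD.not_arc_self v]) fun i j => ?_
    rw [adjMat_localComp_apply hD, ite_mul, one_mul, zero_mul]
  · exact Matrix.rank_eq_of_add_mul_row (c := fun i => if i = w then 1 else 0) (v := u)
      (by simp [huw]) (adjMat_slide_apply D u w)
end

section
/- Let D be an acyclic digraph. For every vertex v, the sibling relation is preserved by local complementation: for all vertices x, y, N⁻_D(x) = N⁻_D(y) if and only if N⁻_{D*v}(x) = N⁻_{D*v}(y). Likewise, for distinct vertices u, w with N⁻_D(u) = N⁻_D(w), one has N⁻_D(x) = N⁻_D(y) if and only if N⁻_{D Δ uw}(x) = N⁻_{D Δ uw}(y). -/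
/-!
Digraphs on a finite vertex set `V` are modelled as irreflexive relations,
encoded as functions `V → V → Bool`.
-/

variable {V : Type*} [Fintype V] [DecidableEq V]

theorem inN_eq_inN_iff {W : Type*} [Fintype W] {D : W → W → Bool} {x y : W} :
    inN D x = inN D y ↔ ∀ a, D a x = D a y := by
  simp only [inN, Finset.ext_iff, Finset.mem_filter, Finset.mem_univ, true_and]
  exact forall_congr' fun a => Bool.eq_iff_iff.symm

/-- Adding the row of `p` to some rows other than that of `p` preserves siblings. -/
theorem inN_eq_inN_iff_of_add_row {W : Type*} [Fintype W] {D H : W → W → Bool} {p : W}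
    {c : W → Bool}
    (hp : c p = false) (hH : ∀ a b, H a b = xor (D a b) (c a && D p b)) (x y : W) :
    inN D x = inN D y ↔ inN H x = inN H y := by
  simp only [inN_eq_inN_iff, hH]
  refine ⟨fun h a => by rw [h a, h p], fun h a => ?_⟩
  have hrow : D p x = D p y := by simpa [hp] using h p
  simpa [hrow] using h a

theorem localComp_eq_xor {W : Type*} [DecidableEq W] {D : W → W → Bool}
    (hD : IsAcyclic D) (v a b : W) :
    localComp D v a b = xor (D a b) (D a v && D v b) := by
  have hab : D a v = true → D v b = true → a ≠ b := by
    rintro h₁ h₂ rfl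
    exact hD a (.tail (.single h₁) h₂)
  unfold localComp
  cases h₁ : D a v <;> cases h₂ : D v b <;> simp_all

theorem slide_eq_xor {W : Type*} [DecidableEq W] (D : W → W → Bool) (u w a b : W) :
    slide D u w a b = xor (D a b) (decide (a = w) && D u b) := by
  by_cases h : a = w <;> simp [slide, h]

/-- Let `D` be an acyclic digraph. For every vertex `v` the
sibling relation is preserved by local complementation: `N⁻_D(x) = N⁻_D(y)` iff
`N⁻_{D*v}(x) = N⁻_{D*v}(y)`. Likewise, for distinct `u, w` with
`N⁻_D(u) = N⁻_D(w)`, `N⁻_D(x) = N⁻_D(y)` iff `N⁻_{D Δ uw}(x) = N⁻_{D Δ uw}(y)`. -/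
theorem sibling_localComp_slide (D : V → V → Bool) (hD : IsAcyclic D) :
    (∀ v x y : V,
      inN D x = inN D y ↔ inN (localComp D v) x = inN (localComp D v) y) ∧
    (∀ u w : V, u ≠ w → inN D u = inN D w → ∀ x y : V,
      inN D x = inN D y ↔ inN (slide D u w) x = inN (slide D u w) y) := by
  refine ⟨fun v => ?_, fun u w huw _ => ?_⟩
  · have hv : D v v = false := by
      simpa using fun h : D v v = true => hD v (.single h)
    exact inN_eq_inN_iff_of_add_row (c := fun a => D a v) hv (localComp_eq_xor hD v)
  · exact inN_eq_inN_iff_of_add_row (c := fun a => decide (a = w)) (by simpa using huw)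
      (slide_eq_xor D u w)
end
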